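/- Let k be a field, let n ≥ 3 be an integer, and let k(Sₙ) = k[x₁, …, xₙ]/(x₁ x_i : 2 ≤ i ≤ n) be the edge ring of the star graph Sₙ on n vertices. Then cs(k(Sₙ)) = n and ms(k(Sₙ)) = n − 1. -/

import Mathlib

/-- The minimal number of generators of an ideal. -/
noncomputable def mu {R : Type*} [CommRing R] (I : Ideal R) : ℕ :=
  sInf {m : ℕ | ∃ s : Finset R, s.card = m ∧ Ideal.span (s : Set R) = I}

/-- The image `m̄` of the irrelevant maximal ideal `m = (x₁, …, xₙ)` in the quotient
`k[x₁, …, xₙ]/I`. -/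
noncomputable def mbar {k : Type*} [Field k] {n : ℕ}
    (I : Ideal (MvPolynomial (Fin n) k)) : Ideal (MvPolynomial (Fin n) k ⧸ I) :=
  Ideal.map (Ideal.Quotient.mk I)
    (Ideal.span (Set.range (MvPolynomial.X : Fin n → MvPolynomial (Fin n) k)))

/-- An ideal of the quotient `k[x₁, …, xₙ]/I` is homogeneous if it is generated by the
images of a set of homogeneous polynomials. -/
def IsHomogeneousQuotIdeal {k : Type*} [Field k] {n : ℕ}
    (I : Ideal (MvPolynomial (Fin n) k))
    (J : Ideal (MvPolynomial (Fin n) k ⧸ I)) : Prop :=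
  ∃ T : Set (MvPolynomial (Fin n) k),
    (∀ p ∈ T, ∃ d : ℕ, MvPolynomial.IsHomogeneous p d) ∧
    J = Ideal.map (Ideal.Quotient.mk I) (Ideal.span T)

/-- `cs` of the standard graded algebra `k[x₁, …, xₙ]/I`:
the minimum of `μ(J)` over the homogeneous ideals `J ⊆ m̄` with `J² = m̄²`. -/
noncomputable def csGr {k : Type*} [Field k] {n : ℕ}
    (I : Ideal (MvPolynomial (Fin n) k)) : ℕ :=
  sInf {m : ℕ | ∃ J : Ideal (MvPolynomial (Fin n) k ⧸ I),
    IsHomogeneousQuotIdeal I J ∧ J ≤ mbar I ∧ J ^ 2 = (mbar I) ^ 2 ∧ mu J = m}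

/-- `ms` of the standard graded algebra `k[x₁, …, xₙ]/I`:
the minimum of `μ(J)` over the homogeneous ideals `J ⊆ m̄` with `m̄² ⊆ J`. -/
noncomputable def msGr {k : Type*} [Field k] {n : ℕ}
    (I : Ideal (MvPolynomial (Fin n) k)) : ℕ :=
  sInf {m : ℕ | ∃ J : Ideal (MvPolynomial (Fin n) k ⧸ I),
    IsHomogeneousQuotIdeal I J ∧ J ≤ mbar I ∧ (mbar I) ^ 2 ≤ J ∧ mu J = m}

/-- The edge ideal of the star graph `Sₙ` on the vertices `{1, …, n}` (realized as
`Fin n` with centre `0`): `I(Sₙ) = (x₁ x_i : 2 ≤ i ≤ n)`. -/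
noncomputable def edgeIdealStar (k : Type*) [Field k] (n : ℕ) (hn : 3 ≤ n) :
    Ideal (MvPolynomial (Fin n) k) :=
  Ideal.span {p : MvPolynomial (Fin n) k |
    ∃ i : Fin n, (i : ℕ) ≠ 0 ∧
      p = MvPolynomial.X (⟨0, by omega⟩ : Fin n) * MvPolynomial.X i}

open MvPolynomial

theorem mu_le_card {R : Type*} [CommRing R] (I : Ideal R) (s : Finset R)
    (h : Ideal.span (s : Set R) = I) : mu I ≤ s.card :=
  Nat.sInf_le ⟨s, rfl, h⟩

theorem mu_spec {R : Type*} [CommRing R] [IsNoetherianRing R] (I : Ideal R) :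
    ∃ s : Finset R, s.card = mu I ∧ Ideal.span (s : Set R) = I := by
  have hne : {m : ℕ | ∃ s : Finset R, s.card = m ∧ Ideal.span (s : Set R) = I}.Nonempty := by
    obtain ⟨s, hs⟩ := IsNoetherian.noetherian I
    exact ⟨s.card, s, rfl, hs⟩
  exact Nat.sInf_mem hne

/-- lifts of generators -/
theorem exists_lift {S : Type*} [CommRing S] (I : Ideal S) [IsNoetherianRing S]
    (J : Ideal (S ⧸ I)) :
    ∃ t : Finset S, t.card ≤ mu J ∧
      Ideal.comap (Ideal.Quotient.mk I) J = Ideal.span (t : Set S) ⊔ I := by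
  classical
  obtain ⟨s, hs, hJ⟩ := mu_spec J
  refine ⟨s.image Quotient.out, hs ▸ Finset.card_image_le, ?_⟩
  have : J = Ideal.map (Ideal.Quotient.mk I)
      (Ideal.span ((s.image Quotient.out : Finset S) : Set S)) := by
    rw [Ideal.map_span, Finset.coe_image, ← Set.image_comp, ← hJ]
    congr 1
    have : (⇑(Ideal.Quotient.mk I) ∘ Quotient.out : S ⧸ I → S ⧸ I) = id := by
      funext x
      exact Quotient.out_eq' x
    rw [this, Set.image_id]
  conv_lhs => rw [this]
  rw [Ideal.comap_map_of_surjective _ Ideal.Quotient.mk_surjective]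
  congr 1
  exact Ideal.mk_ker

section height
variable {k : Type*} [Field k] {n : ℕ}

/-- kill the first `j` variables -/
noncomputable def killv (k : Type*) [Field k] (n j : ℕ) :
    MvPolynomial (Fin n) k →ₐ[k] MvPolynomial (Fin n) k :=
  aeval (fun i : Fin n => if (i : ℕ) < j then 0 else X i)

theorem killv_height (j : ℕ) (hj : j ≤ n) :
    (j : ℕ∞) ≤ (RingHom.ker (killv k n j)).height := by
  induction j with
  | zero => simp
  | succ j ih =>
    have h1 := ih (by omega)
    have hcomp : (killv k n (j+1)).comp (killv k n j) = killv k n (j+1) := by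
      apply MvPolynomial.algHom_ext
      intro i
      by_cases hi : (i : ℕ) < j
      · have : ¬ (j < (i : ℕ)) := by omega
        simp [killv, hi, this]
      · simp [killv, hi]
    have hlt : RingHom.ker (killv k n j) < RingHom.ker (killv k n (j+1)) := by
      refine lt_of_le_of_ne ?_ ?_
      · intro f hf
        rw [RingHom.mem_ker] at hf ⊢
        rw [← hcomp, AlgHom.comp_apply, hf, map_zero]
      · intro h
        have : (X ⟨j, by omega⟩ : MvPolynomial (Fin n) k) ∈ RingHom.ker (killv k n (j+1)) := by
          simp [RingHom.mem_ker, killv]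
        rw [← h] at this
        simp [RingHom.mem_ker, killv] at this
    have i1 : (RingHom.ker (killv k n j)).IsPrime := RingHom.ker_isPrime (killv k n j).toRingHom
    have i2 : (RingHom.ker (killv k n (j+1))).IsPrime := RingHom.ker_isPrime (killv k n (j+1)).toRingHom
    have := Ideal.height_add_one_le_of_lt_of_isPrime hlt
    push_cast
    exact le_trans (by gcongr) this

theorem ker_const : RingHom.ker (killv k n n) =
    Ideal.span (Set.range (X : Fin n → MvPolynomial (Fin n) k)) := by
  apply le_antisymm
  · have key : ∀ f : MvPolynomial (Fin n) k, f - killv k n n f ∈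
        Ideal.span (Set.range (X : Fin n → MvPolynomial (Fin n) k)) := by
      intro f
      induction f using MvPolynomial.induction_on with
      | C a => simp [killv]
      | add p q hp hq =>
        rw [map_add, add_sub_add_comm]
        exact add_mem hp hq
      | mul_X p i hp =>
        have : killv k n n (p * X i) = 0 := by simp [killv]
        rw [this, sub_zero]
        exact Ideal.mul_mem_left _ _ (Ideal.subset_span ⟨i, rfl⟩)
    intro f hf
    have := key f
    rw [RingHom.mem_ker] at hf
    rwa [hf, sub_zero] at this
  · rw [Ideal.span_le]
    rintro _ ⟨i, rfl⟩
    simp [RingHom.mem_ker, killv]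

theorem le_card_of_primary (s : Finset (MvPolynomial (Fin n) k))
    (h1 : Ideal.span (s : Set (MvPolynomial (Fin n) k)) ≤ Ideal.span (Set.range X))
    (h2 : (Ideal.span (Set.range X)) ^ 2 ≤ Ideal.span (s : Set (MvPolynomial (Fin n) k))) :
    n ≤ s.card := by
  have hp : (Ideal.span (Set.range (X : Fin n → MvPolynomial (Fin n) k))).IsPrime := by
    rw [← ker_const]; exact RingHom.ker_isPrime (killv k n n).toRingHom
  have hm : Ideal.span (Set.range (X : Fin n → MvPolynomial (Fin n) k)) ∈
      (Ideal.span (s : Set (MvPolynomial (Fin n) k))).minimalPrimes := by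
    refine ⟨⟨hp, h1⟩, ?_⟩
    rintro q ⟨hq, hsq⟩ _
    exact (Ideal.IsPrime.pow_le_iff (P := q) (by norm_num : (2:ℕ) ≠ 0)).1 (h2.trans hsq)
  have h3 := Ideal.height_le_card_of_mem_minimalPrimes_span_finset hm
  have h4 := killv_height (k := k) (n := n) n le_rfl
  rw [ker_const] at h4
  exact_mod_cast h4.trans h3

end height

section lines
variable {k : Type*} [Field k] {n : ℕ}

/-- restriction to the line through `P` -/
noncomputable def lineMap (P : Fin n → k) : MvPolynomial (Fin n) k →ₐ[k] Polynomial k :=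
  aeval (fun i => Polynomial.C (P i) * Polynomial.X)

theorem lineMap_coeff_zero (P : Fin n → k) (f : MvPolynomial (Fin n) k) :
    (lineMap P f).coeff 0 = constantCoeff f := by
  induction f using MvPolynomial.induction_on with
  | C a => simp [lineMap]
  | add p q hp hq => simp [hp, hq]
  | mul_X p i hp => simp [lineMap, Polynomial.mul_coeff_zero]

theorem lineMap_coeff_one (P : Fin n → k) (f : MvPolynomial (Fin n) k) :
    (lineMap P f).coeff 1 = ∑ i, P i * constantCoeff (pderiv i f) := by
  induction f using MvPolynomial.induction_on with
  | C a => simp [lineMap, Polynomial.coeff_C]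
  | add p q hp hq => simp [hp, hq, mul_add, Finset.sum_add_distrib]
  | mul_X p j hp =>
    have : lineMap P (p * X j) = (lineMap P p * Polynomial.C (P j)) * Polynomial.X := by
      simp [lineMap, mul_assoc]
    rw [this, Polynomial.coeff_mul_X, Polynomial.coeff_mul_C, lineMap_coeff_zero]
    simp [Derivation.leibniz, pderiv_X, Pi.single_apply]
    rw [Finset.sum_eq_single j]
    · simp [mul_comm]
    · intro b _ hb
      simp [Ne.symm hb]
    · simp

theorem coeff_two_mul (f g : Polynomial k) (hf : f.coeff 0 = 0) (hg : g.coeff 0 = 0) :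
    (f * g).coeff 2 = f.coeff 1 * g.coeff 1 := by
  have : Finset.HasAntidiagonal.antidiagonal (2 : ℕ) = {(0,2),(1,1),(2,0)} := rfl
  simp [Polynomial.coeff_mul, this, hf, hg]

theorem coeff_one_mul (f g : Polynomial k) (hg : g.coeff 0 = 0) :
    (f * g).coeff 1 = f.coeff 0 * g.coeff 1 := by
  have : Finset.HasAntidiagonal.antidiagonal (1 : ℕ) = {(0,1),(1,0)} := rfl
  simp [Polynomial.coeff_mul, this, hg]

end lines

theorem max_const {k : Type*} [Field k] {n : ℕ} {f : MvPolynomial (Fin n) k}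
    (hf : f ∈ Ideal.span (Set.range (X : Fin n → MvPolynomial (Fin n) k))) :
    constantCoeff f = 0 := by
  have : Ideal.span (Set.range (X : Fin n → MvPolynomial (Fin n) k)) ≤
      RingHom.ker (constantCoeff (σ := Fin n) (R := k)) := by
    rw [Ideal.span_le]
    rintro _ ⟨i, rfl⟩
    simp [RingHom.mem_ker]
  exact this hf

theorem star_le {k : Type*} [Field k] (n : ℕ) (hn : 3 ≤ n) :
    edgeIdealStar k n hn ≤ Ideal.span {X (⟨0, by omega⟩ : Fin n)} := by
  rw [edgeIdealStar, Ideal.span_le]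
  rintro _ ⟨i, _, rfl⟩
  exact Ideal.mul_mem_right _ _ (Ideal.subset_span rfl)

theorem star_le_max {k : Type*} [Field k] (n : ℕ) (hn : 3 ≤ n) :
    edgeIdealStar k n hn ≤ Ideal.span (Set.range X) :=
  (star_le n hn).trans (Ideal.span_mono (by rintro _ rfl; exact ⟨_, rfl⟩))

theorem lineMap_star {k : Type*} [Field k] (n : ℕ) (hn : 3 ≤ n) (P : Fin n → k)
    (hP : ∀ i : Fin n, (i : ℕ) ≠ 0 → P ⟨0, by omega⟩ * P i = 0)
    {f : MvPolynomial (Fin n) k} (hf : f ∈ edgeIdealStar k n hn) : lineMap P f = 0 := by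
  have : edgeIdealStar k n hn ≤ RingHom.ker (lineMap P) := by
    rw [edgeIdealStar, Ideal.span_le]
    rintro _ ⟨i, hi, rfl⟩
    have h := hP i hi
    rw [SetLike.mem_coe, RingHom.mem_ker]
    have h2 : lineMap P (X (⟨0, by omega⟩ : Fin n) * X i) =
        Polynomial.C (P ⟨0, by omega⟩ * P i) * Polynomial.X ^ 2 := by
      simp [lineMap]; ring
    rw [h2, h]; simp
  exact this hf

theorem cs_lower {k : Type*} [Field k] (n : ℕ) (hn : 3 ≤ n)
    (I : Ideal (MvPolynomial (Fin n) k)) (hI : I = edgeIdealStar k n hn)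
    (J : Ideal (MvPolynomial (Fin n) k ⧸ I))
    (h1 : J ≤ mbar I)
    (h2 : J ^ 2 = (mbar I) ^ 2) : n ≤ mu J := by
  classical
  obtain ⟨t, ht, hJ⟩ := exists_lift I J
  refine le_trans ?_ ht
  by_contra hlt
  push Not at hlt
  -- find p
  let z : Fin n := ⟨0, by omega⟩
  let A : (Fin n → k) →ₗ[k] (t → k) :=
    LinearMap.pi fun g => ∑ i, (constantCoeff (pderiv i g.1)) • LinearMap.proj i
  have hker : LinearMap.ker A ≠ ⊥ := LinearMap.ker_ne_bot_of_finrank_lt (by simpa using hlt)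
  obtain ⟨p, hpA, hp0⟩ := (Submodule.ne_bot_iff _).1 hker
  have hp : ∀ g ∈ t, ∑ i, p i * constantCoeff (pderiv i g) = 0 := by
    intro g hg
    have := congrFun (LinearMap.mem_ker.1 hpA) ⟨g, hg⟩
    simpa [A, mul_comm] using this
  let P : Fin n → k := fun i => if i = z then p i else 0
  let Q : Fin n → k := fun i => if i = z then 0 else - p i
  have hPI : ∀ f ∈ I, lineMap P f = 0 := fun f hf => lineMap_star n hn P (by
    intro i hi
    have : i ≠ z := fun h => hi (by rw [h])
    simp [P, this]) (hI ▸ hf)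
  have hQI : ∀ f ∈ I, lineMap Q f = 0 := fun f hf => lineMap_star n hn Q (by
    intro i hi
    simp [Q, z]) (hI ▸ hf)
  have hmax : Ideal.comap (Ideal.Quotient.mk I) (mbar I) = Ideal.span (Set.range X) := by
    rw [mbar, Ideal.comap_map_of_surjective _ Ideal.Quotient.mk_surjective]
    refine sup_eq_left.2 ?_
    refine le_trans (le_of_eq Ideal.mk_ker) (hI ▸ star_le_max n hn)
  have hJm : Ideal.span (t : Set (MvPolynomial (Fin n) k)) ⊔ I ≤ Ideal.span (Set.range X) := by
    rw [← hJ, ← hmax]; exact Ideal.comap_mono h1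
  have hlin : ∀ f ∈ Ideal.span (t : Set (MvPolynomial (Fin n) k)),
      (lineMap P f).coeff 1 = (lineMap Q f).coeff 1 := by
    intro f hf
    induction hf using Submodule.span_induction with
    | mem g hg =>
      have := hp g hg
      rw [lineMap_coeff_one, lineMap_coeff_one, ← sub_eq_zero, ← Finset.sum_sub_distrib, ← this]
      refine Finset.sum_congr rfl fun i _ => ?_
      by_cases hi : i = z <;> simp [P, Q, hi]
    | zero => simp
    | add x y _ _ hx hy => simp [hx, hy]
    | smul a x hx' hx =>
      have hc : constantCoeff x = 0 := max_const (hJm (Ideal.mem_sup_left hx'))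
      rw [smul_eq_mul, map_mul, map_mul, coeff_one_mul _ _ (by rw [lineMap_coeff_zero, hc]),
        coeff_one_mul _ _ (by rw [lineMap_coeff_zero, hc]), hx, lineMap_coeff_zero,
        lineMap_coeff_zero]
  have hlin' : ∀ f ∈ Ideal.span (t : Set (MvPolynomial (Fin n) k)) ⊔ I,
      (lineMap P f).coeff 1 = (lineMap Q f).coeff 1 := by
    intro f hf
    obtain ⟨a, ha, b, hb, rfl⟩ := Submodule.mem_sup.1 hf
    simp [hPI b hb, hQI b hb, hlin a ha]
  have hquad : ∀ f ∈ (Ideal.span (t : Set (MvPolynomial (Fin n) k)) ⊔ I) *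
      (Ideal.span (t : Set (MvPolynomial (Fin n) k)) ⊔ I),
      (lineMap P f).coeff 2 = (lineMap Q f).coeff 2 := by
    intro f hf
    induction hf using Submodule.mul_induction_on' with
    | mem_mul_mem a ha b hb =>
      have hca := max_const (hJm ha)
      have hcb := max_const (hJm hb)
      rw [map_mul, map_mul, coeff_two_mul, coeff_two_mul, hlin' a ha, hlin' b hb] <;>
        rw [lineMap_coeff_zero] <;> assumption
    | add x _ y _ hx hy => simp [hx, hy]
  have hX : ∀ i : Fin n, (lineMap P (X i ^ 2)).coeff 2 = (lineMap Q (X i ^ 2)).coeff 2 := by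
    intro i
    have hmem : Ideal.Quotient.mk I (X i ^ 2) ∈ J ^ 2 := by
      rw [h2, map_pow]
      exact Ideal.pow_mem_pow (Ideal.mem_map_of_mem _ (Ideal.subset_span (Set.mem_range_self i))) 2
    have hJ' : J = Ideal.map (Ideal.Quotient.mk I)
        (Ideal.span (t : Set (MvPolynomial (Fin n) k)) ⊔ I) := by
      rw [← hJ, Ideal.map_comap_of_surjective _ Ideal.Quotient.mk_surjective]
    rw [hJ', ← Ideal.map_pow, Ideal.mem_map_iff_of_surjective _ Ideal.Quotient.mk_surjective]
      at hmem
    obtain ⟨f, hf, hfe⟩ := hmem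
    have hd : X i ^ 2 - f ∈ I := Ideal.Quotient.eq.1 hfe.symm
    rw [pow_two] at hf
    have h3 := hquad f hf
    have h4 : X i ^ 2 = f + (X i ^ 2 - f) := by ring
    rw [h4, map_add, map_add, hPI _ hd, hQI _ hd]
    simpa using h3
  have hX' : ∀ (R : Fin n → k) (i : Fin n), (lineMap R (X i ^ 2)).coeff 2 = R i ^ 2 := by
    intro R i
    have : lineMap R (X i ^ 2) = Polynomial.C (R i ^ 2) * Polynomial.X ^ 2 := by
      simp [lineMap]; ring
    rw [this, Polynomial.coeff_C_mul_X_pow]; simp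
  apply hp0
  funext i
  have := hX i
  rw [hX', hX'] at this
  by_cases hi : i = z
  · simpa [P, Q, hi] using this
  · simpa [P, Q, hi] using this.symm

theorem ms_lower {k : Type*} [Field k] (n : ℕ) (hn : 3 ≤ n)
    (I : Ideal (MvPolynomial (Fin n) k)) (hI : I = edgeIdealStar k n hn)
    (J : Ideal (MvPolynomial (Fin n) k ⧸ I))
    (h1 : J ≤ mbar I)
    (h2 : (mbar I) ^ 2 ≤ J) : n - 1 ≤ mu J := by
  classical
  obtain ⟨t, ht, hJ⟩ := exists_lift I J
  have hmax : Ideal.comap (Ideal.Quotient.mk I) (mbar I) = Ideal.span (Set.range X) := by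
    rw [mbar, Ideal.comap_map_of_surjective _ Ideal.Quotient.mk_surjective]
    refine sup_eq_left.2 ?_
    refine le_trans (le_of_eq Ideal.mk_ker) (hI ▸ star_le_max n hn)
  have hJm : Ideal.span (t : Set (MvPolynomial (Fin n) k)) ⊔ I ≤ Ideal.span (Set.range X) := by
    rw [← hJ, ← hmax]; exact Ideal.comap_mono h1
  have hmJ : (Ideal.span (Set.range X)) ^ 2 ≤
      Ideal.span (t : Set (MvPolynomial (Fin n) k)) ⊔ I := by
    rw [← hJ, ← Ideal.map_le_iff_le_comap, Ideal.map_pow]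
    exact h2
  have := le_card_of_primary (insert (X (⟨0, by omega⟩ : Fin n)) t) (by
    rw [Finset.coe_insert, Ideal.span_insert]
    refine sup_le ?_ (le_sup_left.trans hJm)
    exact Ideal.span_mono (by rintro _ rfl; exact ⟨_, rfl⟩)) (by
    rw [Finset.coe_insert, Ideal.span_insert]
    refine hmJ.trans (sup_le le_sup_right (le_trans (hI ▸ star_le n hn) le_sup_left)))
  have h3 := Finset.card_insert_le (X (⟨0, by omega⟩ : Fin n)) t
  omega

/-- generators for the ms upper bound -/
noncomputable def msGen (k : Type*) [Field k] (n : ℕ) (hn : 3 ≤ n) (i : Fin n) :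
    MvPolynomial (Fin n) k :=
  if (i : ℕ) = 1 then X ⟨0, by omega⟩ + X i else X i

theorem sq_mem {R : Type*} [CommRing R] {n : ℕ} (x : Fin n → R) (K : Ideal R) (z o : Fin n)
    (hbig : ∀ i : Fin n, i ≠ z → i ≠ o → x i ∈ K) (hu : x z + x o ∈ K) (hzo : x z * x o = 0)
    (i j : Fin n) : x i * x j ∈ K := by
  by_cases hi : i ≠ z ∧ i ≠ o
  · exact Ideal.mul_mem_right _ _ (hbig i hi.1 hi.2)
  by_cases hj : j ≠ z ∧ j ≠ o
  · exact Ideal.mul_mem_left _ _ (hbig j hj.1 hj.2)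
  have hi' : i = z ∨ i = o := by tauto
  have hj' : j = z ∨ j = o := by tauto
  have hz2 : x z * x z = x z * (x z + x o) := by
    rw [mul_add, hzo, add_zero]
  have ho2 : x o * x o = x o * (x z + x o) := by
    rw [mul_add, mul_comm (x o) (x z), hzo, zero_add]
  rcases hi' with hi' | hi' <;> rcases hj' with hj' | hj' <;> rw [hi', hj']
  · rw [hz2]; exact Ideal.mul_mem_left _ _ hu
  · rw [hzo]; exact zero_mem _
  · rw [mul_comm, hzo]; exact zero_mem _
  · rw [ho2]; exact Ideal.mul_mem_left _ _ hu

theorem ms_upper {k : Type*} [Field k] (n : ℕ) (hn : 3 ≤ n)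
    (I : Ideal (MvPolynomial (Fin n) k)) (hI : I = edgeIdealStar k n hn) :
    ∃ J : Ideal (MvPolynomial (Fin n) k ⧸ I),
      IsHomogeneousQuotIdeal I J ∧ J ≤ mbar I ∧ (mbar I) ^ 2 ≤ J ∧ mu J ≤ n - 1 := by
  classical
  obtain ⟨z, hz⟩ : ∃ z : Fin n, z = ⟨0, by omega⟩ := ⟨_, rfl⟩
  obtain ⟨o, ho⟩ : ∃ o : Fin n, o = ⟨1, by omega⟩ := ⟨_, rfl⟩
  obtain ⟨T, hT⟩ : ∃ T : Finset (MvPolynomial (Fin n) k),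
    T = (Finset.univ.erase z).image (msGen k n hn) := ⟨_, rfl⟩
  have hTmem : ∀ i : Fin n, i ≠ z → Ideal.Quotient.mk I (msGen k n hn i) ∈
      Ideal.map (Ideal.Quotient.mk I) (Ideal.span (T : Set (MvPolynomial (Fin n) k))) := by
    intro i hi
    refine Ideal.mem_map_of_mem _ (Ideal.subset_span ?_)
    rw [hT]
    exact Finset.mem_coe.2 (Finset.mem_image_of_mem _ (by simp [hi]))
  refine ⟨Ideal.map (Ideal.Quotient.mk I) (Ideal.span (T : Set (MvPolynomial (Fin n) k))),
    ⟨T, ?_, rfl⟩, ?_, ?_, ?_⟩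
  · intro f hf
    rw [hT] at hf
    obtain ⟨i, _, rfl⟩ := Finset.mem_image.1 (Finset.mem_coe.1 hf)
    refine ⟨1, ?_⟩
    unfold msGen
    split_ifs
    · exact (isHomogeneous_X _ _).add (isHomogeneous_X _ _)
    · exact isHomogeneous_X _ _
  · refine Ideal.map_mono (Ideal.span_le.2 ?_)
    intro f hf
    rw [hT] at hf
    obtain ⟨i, _, rfl⟩ := Finset.mem_image.1 (Finset.mem_coe.1 hf)
    unfold msGen
    split_ifs
    · exact add_mem (Ideal.subset_span (Set.mem_range_self _))
        (Ideal.subset_span (Set.mem_range_self _))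
    · exact Ideal.subset_span (Set.mem_range_self _)
  · rw [mbar, Ideal.map_span, pow_two, Ideal.span_mul_span', Ideal.span_le]
    rintro _ ⟨_, ⟨_, ⟨i, rfl⟩, rfl⟩, _, ⟨_, ⟨j, rfl⟩, rfl⟩, rfl⟩
    refine sq_mem (fun i => Ideal.Quotient.mk I (X i)) _ z o ?_ ?_ ?_ i j
    · intro i hi hio
      have h := hTmem i hi
      have : ¬ ((i : ℕ) = 1) := fun h => hio (by rw [ho]; exact Fin.ext h)
      rwa [msGen, if_neg this] at h
    · have h := hTmem o (by rw [ho, hz]; simp)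
      rwa [msGen, if_pos (by rw [ho]), map_add, ← hz] at h
    · change Ideal.Quotient.mk I (X z) * Ideal.Quotient.mk I (X o) = 0
      rw [← map_mul, Ideal.Quotient.eq_zero_iff_mem, hI, hz]
      exact Ideal.subset_span ⟨o, by simp [ho], rfl⟩
  · refine (mu_le_card _ (T.image (Ideal.Quotient.mk I)) ?_).trans ?_
    · rw [Finset.coe_image, Ideal.map_span]
    · refine Finset.card_image_le.trans ?_
      rw [hT]
      refine Finset.card_image_le.trans ?_
      simp

theorem mu_mbar_le {k : Type*} [Field k] {n : ℕ} (I : Ideal (MvPolynomial (Fin n) k)) :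
    mu (mbar I) ≤ n := by
  classical
  refine (mu_le_card _ ((Finset.univ.image (X : Fin n → MvPolynomial (Fin n) k)).image
    (Ideal.Quotient.mk I)) ?_).trans ?_
  · rw [mbar, Finset.coe_image, Ideal.map_span]; simp
  · exact Finset.card_image_le.trans (Finset.card_image_le.trans (by simp))

/-- Let `k(Sₙ) = k[x₁, …, xₙ]/(x₁ x_i : 2 ≤ i ≤ n)` be the edge ring of the star graph
on `n ≥ 3` vertices.  Then `cs(k(Sₙ)) = n` and `ms(k(Sₙ)) = n − 1`. -/
theorem stmt19 {k : Type*} [Field k] (n : ℕ) (hn : 3 ≤ n) :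
    csGr (edgeIdealStar k n hn) = n ∧ msGr (edgeIdealStar k n hn) = n - 1 := by
  constructor
  · have hm : n ∈ {m : ℕ | ∃ J : Ideal (MvPolynomial (Fin n) k ⧸ edgeIdealStar k n hn),
        IsHomogeneousQuotIdeal (edgeIdealStar k n hn) J ∧ J ≤ mbar (edgeIdealStar k n hn) ∧
        J ^ 2 = (mbar (edgeIdealStar k n hn)) ^ 2 ∧ mu J = m} := by
      refine ⟨mbar _, ⟨Set.range X, ?_, rfl⟩, le_rfl, rfl,
        le_antisymm (mu_mbar_le _) (cs_lower n hn _ rfl _ le_rfl rfl)⟩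
      rintro _ ⟨i, rfl⟩
      exact ⟨1, isHomogeneous_X _ _⟩
    refine le_antisymm (Nat.sInf_le hm) (le_csInf ⟨n, hm⟩ ?_)
    rintro m ⟨J, _, h1, h2, rfl⟩
    exact cs_lower n hn _ rfl J h1 h2
  · obtain ⟨J, hJ, h1, h2, h3⟩ := ms_upper (k := k) n hn _ rfl
    have hm : n - 1 ∈ {m : ℕ | ∃ J : Ideal (MvPolynomial (Fin n) k ⧸ edgeIdealStar k n hn),
        IsHomogeneousQuotIdeal (edgeIdealStar k n hn) J ∧ J ≤ mbar (edgeIdealStar k n hn) ∧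
        (mbar (edgeIdealStar k n hn)) ^ 2 ≤ J ∧ mu J = m} :=
      ⟨J, hJ, h1, h2, le_antisymm h3 (ms_lower n hn _ rfl J h1 h2)⟩
    refine le_antisymm (Nat.sInf_le hm) (le_csInf ⟨n - 1, hm⟩ ?_)
    rintro m ⟨J, _, h1, h2, rfl⟩
    exact ms_lower n hn _ rfl J h1 h2
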